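/- arXiv:1708.02222 — 2 statements merged into one kernel-verified Lean document; each statement's English description precedes it below -/
import Mathlib

section
/- Let M be a connected regular matroid on a finite ground set E with m = |E| ≥ 2, let w : E → ℕ be a weight function, let r be a positive integer, and let ẽ ∈ E be a fixed element. Suppose there is no circuit C of M with ẽ ∉ C and w(C) < r. Then the number of circuits C of M with ẽ ∈ C and w(C) < r is at most 48·(m − 1)². -/
/-- A circuit of a matroid: an inclusionwise minimal dependent set. -/
def Matroid.IsCircuitSet {α : Type*} (M : Matroid α) (C : Set α) : Prop :=
  M.Dep C ∧ ∀ D ⊂ C, ¬ M.Dep D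

/-- A matroid on a finite ground set is *regular* if it can be represented over `ℝ`
by a totally unimodular matrix (equivalently, it is representable over every field). -/
def Matroid.IsRegular {E : Type*} [Fintype E] (M : Matroid E) : Prop :=
  ∃ (n : ℕ) (A : Matrix (Fin n) E ℝ), A.IsTotallyUnimodular ∧
    ∀ S : Set E, M.Indep S ↔ LinearIndependent ℝ (fun e : S => A.transpose (e : E))

/-- The weight of a set of elements under a weight function `w`. -/
noncomputable def wSet {E : Type*} (w : E → ℕ) (C : Set E) : ℕ := ∑ᶠ e ∈ C, w e

/-- A matroid is connected if it cannot be written as a direct sum (1-sum) of two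
matroids, each on a nonempty ground set. -/
def Matroid.IsConnectedMatroid {α : Type*} (M : Matroid α) : Prop :=
  ∀ (M₁ M₂ : Matroid α) (h : Disjoint M₁.E M₂.E),
    M = Matroid.disjointSum M₁ M₂ h → M₁.E = ∅ ∨ M₂.E = ∅

open Matrix in
/-- If `y` lies in the kernel of a totally unimodular matrix and the columns in the support of `y`
other than `e` are independent, then all nonzero entries of `y` agree up to sign. -/
lemma Matrix.IsTotallyUnimodular.eq_zero_or_eq_or_eq_neg {E : Type*} [Fintype E] {n : ℕ}
    {A : Matrix (Fin n) E ℝ} (hA : A.IsTotallyUnimodular) {y : E → ℝ} (hy : A *ᵥ y = 0) {e : E}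
    (hind : LinearIndependent ℝ (fun f : {f : E // f ≠ e ∧ y f ≠ 0} => A.transpose (f : E)))
    (f : E) : y f = 0 ∨ y f = y e ∨ y f = -y e := by
  classical
  by_cases hfe : f = e
  · exact Or.inr (Or.inl (by rw [hfe]))
  by_cases hf0 : y f = 0
  · exact Or.inl hf0
  let I := {f : E // f ≠ e ∧ y f ≠ 0}
  let N : Matrix (Fin n) I ℝ := A.submatrix id (fun f : I => (f : E))
  have hrank : N.rank = Fintype.card I := by
    rw [← Matrix.rank_transpose]
    exact LinearIndependent.rank_matrix (M := Nᵀ) hind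
  have hspan : Submodule.span ℝ (Set.range N.row) = ⊤ := by
    apply Submodule.eq_top_of_finrank_eq
    rw [← Matrix.rank_eq_finrank_span_row, hrank, Module.finrank_fintype_fun_eq_card]
  obtain ⟨κ, a, -, hκspan, hκ⟩ := exists_linearIndependent' ℝ N.row
  have := hκ.finite
  have := Fintype.ofFinite κ
  have hcard : Fintype.card I = Fintype.card κ := by
    have h := finrank_span_eq_card hκ
    rw [hκspan, hspan, finrank_top, Module.finrank_fintype_fun_eq_card] at h
    exact h
  let σ : I ≃ κ := Fintype.equivOfCardEq hcard
  let B : Matrix I I ℝ := A.submatrix (fun i => a (σ i)) (fun f : I => (f : E))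
  have hB : B.det ≠ 0 := by
    have h : LinearIndependent ℝ B.row := hκ.comp σ σ.injective
    exact ((Matrix.isUnit_iff_isUnit_det B).1
      (Matrix.linearIndependent_rows_iff_isUnit.1 h)).ne_zero
  have hTU := (Matrix.isTotallyUnimodular_iff_fintype A).1 hA
  let b : I → ℝ := fun i => A (a (σ i)) e
  have hker : B *ᵥ (fun f : I => y f) + y e • b = 0 := by
    ext i
    have h := congrFun hy (a (σ i))
    simp only [Matrix.mulVec, dotProduct, Pi.zero_apply] at h
    rw [← Finset.add_sum_erase _ _ (Finset.mem_univ e),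
      ← Finset.sum_filter_add_sum_filter_not _ (fun f => y f ≠ 0)] at h
    have h2 : ∑ x ∈ (Finset.univ.erase e).filter (fun f => ¬ y f ≠ 0), A (a (σ i)) x * y x = 0 :=
      Finset.sum_eq_zero fun x hx => by simp at hx; simp [hx.2]
    rw [h2, add_zero] at h
    have h3 : ∑ x ∈ (Finset.univ.erase e).filter (fun f => y f ≠ 0), A (a (σ i)) x * y x
        = ∑ j : I, A (a (σ i)) j * y j :=
      Finset.sum_subtype _ (by simp) (fun x => A (a (σ i)) x * y x)
    rw [h3] at h
    simp only [Matrix.mulVec, dotProduct, Pi.add_apply, Pi.smul_apply, Pi.zero_apply, smul_eq_mul,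
      B, b, Matrix.submatrix_apply]
    linarith
  have hcramer : B.det • (fun f : I => y f) + y e • B.cramer b = 0 := by
    have hinj := Matrix.mulVec_injective_iff_isUnit.2 ((Matrix.isUnit_iff_isUnit_det B).2 hB.isUnit)
    apply hinj
    rw [Matrix.mulVec_add, Matrix.mulVec_smul, Matrix.mulVec_smul, Matrix.mulVec_cramer,
      Matrix.mulVec_zero, smul_comm, ← smul_add, hker, smul_zero]
  have hf := congrFun hcramer ⟨f, hfe, hf0⟩
  simp only [Pi.add_apply, Pi.smul_apply, smul_eq_mul, Pi.zero_apply, Matrix.cramer_apply] at hf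
  have hcol : B.updateCol ⟨f, hfe, hf0⟩ b =
      A.submatrix (fun i => a (σ i)) (fun j : I => if j = ⟨f, hfe, hf0⟩ then e else (j : E)) := by
    ext i j
    by_cases hj : j = ⟨f, hfe, hf0⟩ <;> simp [hj, B, b]
  obtain ⟨s, hs⟩ := hTU _ (fun i => a (σ i)) (fun j : I => if j = ⟨f, hfe, hf0⟩ then e else (j : E))
  obtain ⟨t, ht⟩ := hTU _ (fun i => a (σ i)) (fun j : I => (j : E))
  rw [hcol, ← hs] at hf
  change _ = B.det at ht
  rw [← ht] at hf hB
  rcases s with _ | _ | _ <;> rcases t with _ | _ | _ <;> simp at hf hB ⊢ <;> grind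

open Matrix in
/-- Every entry of a kernel vector of a totally unimodular matrix is covered by
a `{0, ±1}`-valued kernel vector conforming to it. -/
lemma Matrix.IsTotallyUnimodular.exists_conformal {E : Type*} [Fintype E] {n : ℕ}
    {A : Matrix (Fin n) E ℝ} (hA : A.IsTotallyUnimodular) {y : E → ℝ} (hy : A *ᵥ y = 0) {e : E}
    (he : y e ≠ 0) :
    ∃ u : E → ℤ, A *ᵥ (fun f => (u f : ℝ)) = 0 ∧ u e ≠ 0 ∧
      ∀ f, u f = 0 ∨ (u f = 1 ∧ 0 < y f) ∨ (u f = -1 ∧ y f < 0) := by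
  classical
  induction hN : (Finset.univ.filter (fun f => y f ≠ 0)).card using Nat.strong_induction_on
    generalizing y with
  | _ N ih =>
  by_cases hind : LinearIndependent ℝ (fun f : {f : E // f ≠ e ∧ y f ≠ 0} => A.transpose (f : E))
  · have hval := hA.eq_zero_or_eq_or_eq_neg hy hind
    have hu : (fun f => ((SignType.sign (y f) : ℤ) : ℝ)) = |y e|⁻¹ • y := by
      ext f
      have hpos := abs_pos.2 he
      simp only [Pi.smul_apply, smul_eq_mul]
      rw [eq_inv_mul_iff_mul_eq₀ hpos.ne']
      rcases lt_trichotomy (y f) 0 with h | h | h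
      · have : |y e| = |y f| := by rcases hval f with h' | h' | h' <;> simp_all
        simp [sign_neg h, this, abs_of_neg h]
      · simp [h]
      · have : |y e| = |y f| := by rcases hval f with h' | h' | h' <;> simp_all
        simp [sign_pos h, this, abs_of_pos h]
    refine ⟨fun f => (SignType.sign (y f) : ℤ), ?_, ?_, fun f => ?_⟩
    · rw [hu, Matrix.mulVec_smul, hy, smul_zero]
    · rcases he.lt_or_gt with h | h <;> simp [h]
    · rcases lt_trichotomy (y f) 0 with h | h | h <;> simp [h]
  · obtain ⟨c, hc, j₀, hj₀⟩ := Fintype.not_linearIndependent_iff.1 hind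
    let k : E → ℝ := fun f => if h : f ≠ e ∧ y f ≠ 0 then c ⟨f, h⟩ else 0
    have hk0 : A *ᵥ k = 0 := by
      ext i
      have h := congrFun hc i
      simp only [Finset.sum_apply, Pi.smul_apply, smul_eq_mul, Pi.zero_apply,
        Matrix.transpose_apply] at h
      simp only [Matrix.mulVec, dotProduct, Pi.zero_apply]
      rw [← h, ← Finset.sum_filter_add_sum_filter_not _ (fun f => f ≠ e ∧ y f ≠ 0)]
      rw [Finset.sum_eq_zero (s := Finset.univ.filter (fun f => ¬ (f ≠ e ∧ y f ≠ 0)))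
        (fun x hx => by
          simp only [Finset.mem_filter, Finset.mem_univ, true_and] at hx
          simp [k, hx]),
        add_zero]
      rw [Finset.sum_subtype (p := fun f => f ≠ e ∧ y f ≠ 0) _ (by simp) (fun x => A i x * k x)]
      refine Finset.sum_congr rfl fun x _ => ?_
      have hx := x.2
      simp only [k, dif_pos hx]
      ring
    have hks : ∀ f, k f ≠ 0 → f ≠ e ∧ y f ≠ 0 := fun f hf => by
      by_contra h
      exact hf (dif_neg h)
    have hkj : k j₀ ≠ 0 := by
      have hx := j₀.2
      simpa [k, dif_pos hx] using hj₀
    obtain ⟨g, hg, hgmin⟩ := Finset.exists_min_image (Finset.univ.filter (fun f => k f ≠ 0))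
      (fun f => |y f / k f|) ⟨j₀, by simpa using hkj⟩
    simp only [Finset.mem_filter, Finset.mem_univ, true_and] at hg hgmin
    set t := y g / k g with ht
    have hbound : ∀ f, |t * k f| ≤ |y f| := fun f => by
      by_cases hf : k f = 0
      · simp [hf]
      · have h := hgmin f hf
        rw [abs_div (y f), le_div_iff₀ (abs_pos.2 hf)] at h
        rwa [abs_mul]
    have hsupp : ∀ f, (y - t • k) f ≠ 0 → y f ≠ 0 := fun f hf h0 => by
      have := hbound f
      rw [h0, abs_zero, abs_nonpos_iff] at this
      simp [h0, this] at hf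
    have hyg : (y - t • k) g = 0 := by
      simp [ht, div_mul_cancel₀ _ hg]
    have hke : k e = 0 := by
      by_contra h
      exact (hks e h).1 rfl
    obtain ⟨u, hu0, hue, hu⟩ := ih _ (by
        rw [← hN]
        refine Finset.card_lt_card (Finset.ssubset_iff_of_subset ?_ |>.2 ⟨g, ?_, ?_⟩)
        · intro f hf
          simp only [Finset.mem_filter, Finset.mem_univ, true_and] at hf ⊢
          exact hsupp f hf
        · simpa using (hks g hg).2
        · simpa using hyg) (y := y - t • k)
      (by rw [Matrix.mulVec_sub, Matrix.mulVec_smul, hk0, hy]; simp) (by simpa [hke] using he) rfl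
    refine ⟨u, hu0, hue, fun f => ?_⟩
    have hb := abs_le.1 (hbound f)
    rcases hu f with h | ⟨h, h'⟩ | ⟨h, h'⟩
    · exact Or.inl h
    · refine Or.inr (Or.inl ⟨h, ?_⟩)
      simp only [Pi.sub_apply, Pi.smul_apply, smul_eq_mul] at h'
      by_contra hneg
      rw [abs_of_nonpos (not_lt.1 hneg)] at hb
      linarith
    · refine Or.inr (Or.inr ⟨h, ?_⟩)
      simp only [Pi.sub_apply, Pi.smul_apply, smul_eq_mul] at h'
      by_contra hneg
      rw [abs_of_nonneg (not_lt.1 hneg)] at hb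
      linarith

/-- A subgroup of `ℤ^E` in which every nonzero entry of an element is covered, with value `±1`,
by an element lying between `0` and the given one. -/
def AddSubgroup.IsConformal {E : Type*} (L : AddSubgroup (E → ℤ)) : Prop :=
  ∀ y ∈ L, ∀ e, y e ≠ 0 → ∃ u ∈ L, |u e| = 1 ∧ ∀ f, (0 ≤ u f ∧ u f ≤ y f) ∨ (y f ≤ u f ∧ u f ≤ 0)

/-- The `ℓ¹` norm of an integer vector, weighted by `w`. -/
def weightedNorm {E : Type*} [Fintype E] (w : E → ℕ) (y : E → ℤ) : ℤ := ∑ f, (w f : ℤ) * |y f|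

namespace weightedNorm

variable {E : Type*} [Fintype E] (w : E → ℕ)

lemma add_le_add_of_forall {y y' z z' : E → ℤ} (h : ∀ f, |y f| + |y' f| ≤ |z f| + |z' f|) :
    weightedNorm w y + weightedNorm w y' ≤ weightedNorm w z + weightedNorm w z' := by
  simp only [weightedNorm, ← Finset.sum_add_distrib, ← mul_add]
  exact Finset.sum_le_sum fun f _ => mul_le_mul_of_nonneg_left (h f) (by positivity)

lemma add_le_of_forall {y y' z : E → ℤ} (h : ∀ f, |y f| + |y' f| ≤ |z f|) :
    weightedNorm w y + weightedNorm w y' ≤ weightedNorm w z := by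
  simpa [weightedNorm] using add_le_add_of_forall w (z := z) (z' := 0) (by simpa using h)

lemma le_of_forall {y z : E → ℤ} (h : ∀ f, |y f| ≤ |z f|) :
    weightedNorm w y ≤ weightedNorm w z := by
  simpa [weightedNorm] using add_le_of_forall w (y := y) (y' := 0) (z := z) (by simpa using h)

lemma sub_le (y z : E → ℤ) : weightedNorm w (y - z) ≤ weightedNorm w y + weightedNorm w z := by
  simpa [weightedNorm] using
    add_le_add_of_forall w (y := y - z) (y' := 0) (z := y) (z' := z)
      (by simpa using fun f => abs_sub (y f) (z f))

end weightedNorm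

/-- A conformal lattice whose nonzero elements vanishing at `e₀` all have weighted norm at
least `r`. -/
structure IsHeavyOff {E : Type*} [Fintype E] (L : AddSubgroup (E → ℤ)) (w : E → ℕ) (r : ℕ)
    (e₀ : E) : Prop where
  conformal : L.IsConformal
  le_norm : ∀ y ∈ L, y ≠ 0 → y e₀ = 0 → (r : ℤ) ≤ weightedNorm w y

/-- A `{0, 1}`-valued element of `L` of weighted norm less than `r` with value `1` at `e₀`. -/
structure IsLightThrough {E : Type*} [Fintype E] (L : AddSubgroup (E → ℤ)) (w : E → ℕ) (r : ℕ)
    (e₀ : E) (x : E → ℤ) : Prop where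
  mem : x ∈ L
  apply_eq : x e₀ = 1
  norm_lt : weightedNorm w x < r
  eq_zero_or_one : ∀ f, x f = 0 ∨ x f = 1

namespace IsHeavyOff

variable {E : Type*} [Fintype E] {L : AddSubgroup (E → ℤ)} {w : E → ℕ} {r : ℕ} {e₀ : E}

lemma le_norm_sub (hL : IsHeavyOff L w r e₀) {x y : E → ℤ} (hx : x ∈ L) (hy : y ∈ L)
    (hne : x ≠ y) (h₀ : x e₀ = y e₀) : (r : ℤ) ≤ weightedNorm w (x - y) :=
  hL.le_norm _ (L.sub_mem hx hy) (sub_ne_zero.2 hne) (by simp [h₀])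

/-- Two light elements through `e₀` differ by at most one in every coordinate. -/
lemma abs_sub_le_one (hL : IsHeavyOff L w r e₀) {x y : E → ℤ} (hx : x ∈ L) (hy : y ∈ L)
    (hx₀ : x e₀ = 1) (hy₀ : y e₀ = 1) (hxr : weightedNorm w x < r) (hyr : weightedNorm w y < r)
    (f : E) : |x f - y f| ≤ 1 := by
  by_contra! hf
  have hL' := L.sub_mem hx hy
  obtain ⟨u, hu, huf, huc⟩ := hL.conformal _ hL' f (by
    rw [Pi.sub_apply]; intro h; simp [h] at hf)
  have hc₀ := huc e₀
  have hcf := huc f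
  simp only [Pi.sub_apply, hx₀, hy₀] at hc₀ hcf
  have h1 := hL.le_norm u hu (fun h => by simp [h] at huf) (by omega)
  have h2 := hL.le_norm (x - y - u) (L.sub_mem hL' hu)
    (fun h => by
      have := congrFun h f
      simp only [Pi.sub_apply, Pi.zero_apply] at this
      rw [show x f - y f = u f by omega] at hf
      omega)
    (by simp only [Pi.sub_apply, hx₀, hy₀]; omega)
  have h3 := weightedNorm.add_le_of_forall w (y := u) (y' := x - y - u) (z := x - y) (fun g => by
    have := huc g
    simp only [Pi.sub_apply] at this ⊢
    grind)
  have h4 := weightedNorm.sub_le w x y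
  omega

/-- An element with value `1` at `e₀` and `2` at `e` splits off a conformal part with value `1`
at both. -/
lemma exists_split (hL : IsHeavyOff L w r e₀) {y : E → ℤ} (hy : y ∈ L) (hy₀ : y e₀ = 1) {e : E}
    (hye : y e = 2) :
    ∃ z ∈ L, z e₀ = 1 ∧ z e = 1 ∧ (∀ f, (0 ≤ z f ∧ z f ≤ y f) ∨ (y f ≤ z f ∧ z f ≤ 0)) ∧
      weightedNorm w z + r ≤ weightedNorm w y := by
  obtain ⟨u, hu, hue, huc⟩ := hL.conformal y hy e (by omega)
  have key : ∀ z ∈ L, z e₀ = 1 → z e = 1 →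
      (∀ f, (0 ≤ z f ∧ z f ≤ y f) ∨ (y f ≤ z f ∧ z f ≤ 0)) →
      weightedNorm w z + r ≤ weightedNorm w y := fun z hz hz₀ hze hzc => by
    have h1 := hL.le_norm_sub hy hz (fun h => by simp [h, hze] at hye) (by rw [hy₀, hz₀])
    have h2 := weightedNorm.add_le_of_forall w (y := z) (y' := y - z) (z := y) (fun g => by
      have := hzc g
      simp only [Pi.sub_apply]
      grind)
    omega
  have hc₀ := huc e₀
  have hce := huc e
  have hue1 : u e = 1 := by grind
  rcases (by omega : u e₀ = 1 ∨ u e₀ = 0) with h | h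
  · exact ⟨u, hu, h, hue1, huc, key u hu h hue1 huc⟩
  · have hc' : ∀ f, (0 ≤ (y - u) f ∧ (y - u) f ≤ y f) ∨ (y f ≤ (y - u) f ∧ (y - u) f ≤ 0) :=
      fun f => by
        have := huc f
        simp only [Pi.sub_apply]
        omega
    have h₀ : (y - u) e₀ = 1 := by simp [h, hy₀]
    have he : (y - u) e = 1 := by simp [hue1, hye]
    exact ⟨y - u, L.sub_mem hy hu, h₀, he, hc', key _ (L.sub_mem hy hu) h₀ he hc'⟩

/-- The only elements through `e₀` below the sum of two light ones are these two. -/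
lemma eq_or_eq_of_le_add (hL : IsHeavyOff L w r e₀) {x y z : E → ℤ}
    (hx : IsLightThrough L w r e₀ x) (hy : IsLightThrough L w r e₀ y) (hz : z ∈ L)
    (hz₀ : z e₀ = 1) (hle : ∀ f, 0 ≤ z f ∧ z f ≤ x f + y f) : z = x ∨ z = y := by
  by_contra! hne
  have h1 := hL.le_norm_sub hx.mem hz hne.1.symm (by rw [hx.apply_eq, hz₀])
  have h2 := hL.le_norm_sub hy.mem hz hne.2.symm (by rw [hy.apply_eq, hz₀])
  have h3 := weightedNorm.add_le_add_of_forall w (y := x - z) (y' := y - z) (z := x) (z' := y)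
    (fun f => by
      have := hx.eq_zero_or_one f
      have := hy.eq_zero_or_one f
      have := hle f
      simp only [Pi.sub_apply]
      grind)
  have := hx.norm_lt
  have := hy.norm_lt
  omega

/-- If `c ≤ x + y + z` misses a common element of `x` and `y`, where `x`, `y`, `z` are light, then
`y` dominates `c` on `x` or `x` dominates `c` on `y`. -/
lemma dominates_or_dominates (hL : IsHeavyOff L w r e₀) {x y z c : E → ℤ}
    (hx : IsLightThrough L w r e₀ x) (hy : IsLightThrough L w r e₀ y)
    (hz : IsLightThrough L w r e₀ z) (hc : c ∈ L) (hc₀ : c e₀ = 1)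
    (hle : ∀ f, 0 ≤ c f ∧ c f ≤ x f + y f + z f) (hcz : c ≠ z)
    {e : E} (hxe : x e = 1) (hye : y e = 1) (hce : c e = 0) :
    (∀ f, x f = 1 → c f ≤ y f) ∨ (∀ f, y f = 1 → c f ≤ x f) := by
  have hmem : x + y - c ∈ L := L.sub_mem (L.add_mem hx.mem hy.mem) hc
  have hx1 := hx.eq_zero_or_one
  have hy1 := hy.eq_zero_or_one
  have hz1 := hz.eq_zero_or_one
  have hxr := hx.norm_lt
  have hyr := hy.norm_lt
  have hzr := hz.norm_lt
  obtain ⟨v, hv, hv₀, -, hvc, hvr⟩ := hL.exists_split hmem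
    (by simp [hx.apply_eq, hy.apply_eq, hc₀]) (e := e) (by simp [hxe, hye, hce])
  have h1 := hL.le_norm_sub hz.mem hc hcz.symm (by rw [hz.apply_eq, hc₀])
  have h2 : weightedNorm w (x + y - c) + weightedNorm w (z - c)
      ≤ weightedNorm w (x + y) + weightedNorm w z :=
    weightedNorm.add_le_add_of_forall w (fun f => by
      have := hx1 f
      have := hy1 f
      have := hz1 f
      have := hle f
      simp only [Pi.sub_apply, Pi.add_apply]
      grind)
  have h3 : weightedNorm w (x + y) + weightedNorm w 0 ≤ weightedNorm w x + weightedNorm w y :=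
    weightedNorm.add_le_add_of_forall w (fun f => by simpa using abs_add_le (x f) (y f))
  have h4 : weightedNorm w (0 : E → ℤ) = 0 := by simp [weightedNorm]
  have hvz := hL.abs_sub_le_one hv hz.mem hv₀ hz.apply_eq (by omega) hzr
  simp only [Pi.sub_apply, Pi.add_apply] at hvc
  rcases hL.eq_or_eq_of_le_add hx hy hv hv₀ (fun f => by
    have := hx1 f
    have := hy1 f
    have := hz1 f
    have := hle f
    have := hvc f
    have := abs_le.1 (hvz f)
    omega) with rfl | rfl
  · exact Or.inl fun f hf => by
      have := hvc f
      omega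
  · exact Or.inr fun f hf => by
      have := hvc f
      omega

/-- An element through `e₀` that is dominated by a light one is equal to it. -/
lemma eq_of_le (hL : IsHeavyOff L w r e₀) {x c : E → ℤ} (hx : IsLightThrough L w r e₀ x)
    (hc : c ∈ L) (hc₀ : c e₀ = 1) (hle : ∀ f, 0 ≤ c f ∧ c f ≤ x f) : c = x := by
  by_contra hne
  have h1 := hL.le_norm_sub hx.mem hc (Ne.symm hne) (by rw [hx.apply_eq, hc₀])
  have h2 := weightedNorm.le_of_forall w (y := x - c) (z := x) (fun f => by
    have := hle f
    simp only [Pi.sub_apply]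
    grind)
  have := hx.norm_lt
  omega

/-- The possible traces on a triangle `p`, `q`, `s` of an element below the sum of three light
elements that meet pairwise in `p`, `q` and `s`. -/
lemma trace_ne (hL : IsHeavyOff L w r e₀) {x y z c : E → ℤ}
    (hx : IsLightThrough L w r e₀ x) (hy : IsLightThrough L w r e₀ y)
    (hz : IsLightThrough L w r e₀ z) (hc : c ∈ L) (hc₀ : c e₀ = 1)
    (hle : ∀ f, 0 ≤ c f ∧ c f ≤ x f + y f + z f) (hcx : c ≠ x) (hcy : c ≠ y) (hcz : c ≠ z)
    {p q s : E} (hp : x p = 1 ∧ y p = 1 ∧ z p = 0) (hq : x q = 1 ∧ y q = 0 ∧ z q = 1)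
    (hs : x s = 0 ∧ y s = 1 ∧ z s = 1) (hcp : c p ≤ 1) (hcq : c q ≤ 1) (hcs : c s ≤ 1) :
    c p + c q + c s ≠ 0 ∧ c p + c q + c s ≠ 2 := by
  have hdp := hL.dominates_or_dominates hx hy hz hc hc₀ hle hcz hp.1 hp.2.1
  have hdq := hL.dominates_or_dominates hx hz hy hc hc₀ (fun f => by have := hle f; omega)
    hcy hq.1 hq.2.2
  have hds := hL.dominates_or_dominates hy hz hx hc hc₀ (fun f => by have := hle f; omega)
    hcx hs.2.1 hs.2.2
  have hp' := hle p
  have hq' := hle q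
  have hs' := hle s
  refine ⟨fun h => ?_, fun h => ?_⟩
  · have hx1 := hx.eq_zero_or_one
    have hy1 := hy.eq_zero_or_one
    have hz1 := hz.eq_zero_or_one
    have hex : ¬ ∀ f, c f ≤ x f := fun h =>
      hcx (hL.eq_of_le hx hc hc₀ fun f => ⟨(hle f).1, h f⟩)
    have hey : ¬ ∀ f, c f ≤ y f := fun h =>
      hcy (hL.eq_of_le hy hc hc₀ fun f => ⟨(hle f).1, h f⟩)
    have hez : ¬ ∀ f, c f ≤ z f := fun h =>
      hcz (hL.eq_of_le hz hc hc₀ fun f => ⟨(hle f).1, h f⟩)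
    have hdp := hdp (by omega)
    have hdq := hdq (by omega)
    have hds := hds (by omega)
    rcases hdp with h1 | h1 <;> rcases hdq with h2 | h2 <;> rcases hds with h3 | h3 <;>
    exact hex fun f => by grind
  · rcases (by omega : c p = 0 ∨ c q = 0 ∨ c s = 0) with h0 | h0 | h0
    · rcases hdp h0 with h1 | h1
      · have := h1 q hq.1
        omega
      · have := h1 s hs.2.1
        omega
    · rcases hdq h0 with h1 | h1
      · have := h1 p hp.1
        omega
      · have := h1 s hs.2.2
        omega
    · rcases hds h0 with h1 | h1
      · have := h1 p hp.2.1
        omega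
      · have := h1 q hq.2.2
        omega

/-- Three light elements never meet pairwise in three elements outside the third. -/
lemma not_triangle (hL : IsHeavyOff L w r e₀) {x y z : E → ℤ}
    (hx : IsLightThrough L w r e₀ x) (hy : IsLightThrough L w r e₀ y)
    (hz : IsLightThrough L w r e₀ z) {p q s : E} (hp : x p = 1 ∧ y p = 1 ∧ z p = 0)
    (hq : x q = 1 ∧ y q = 0 ∧ z q = 1) (hs : x s = 0 ∧ y s = 1 ∧ z s = 1) : False := by
  have hx1 := hx.eq_zero_or_one
  have hy1 := hy.eq_zero_or_one
  have hz1 := hz.eq_zero_or_one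
  have hx₀ := hx.apply_eq
  have hy₀ := hy.apply_eq
  have hz₀ := hz.apply_eq
  obtain ⟨v, hv, hv₀, hvp, hvc, -⟩ := hL.exists_split
    (L.sub_mem (L.add_mem hx.mem hy.mem) hz.mem) (by simp [hx₀, hy₀, hz₀]) (e := p) (by simp [hp])
  simp only [Pi.sub_apply, Pi.add_apply] at hvc
  have hvq := hvc q
  have hvs := hvc s
  have hsum : ∀ f, 0 ≤ z f + v f ∧ z f + v f ≤ x f + y f + z f := fun f => by
    have := hx1 f
    have := hy1 f
    have := hz1 f
    have := hvc f
    omega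
  obtain ⟨u, hu, hu₀, huc⟩ := hL.conformal (z + v) (L.add_mem hz.mem hv) e₀ (by simp [hz₀, hv₀])
  have huc' : ∀ f, 0 ≤ u f ∧ u f ≤ z f + v f := fun f => by
    have := hsum f
    have := huc f
    simp only [Pi.add_apply] at this
    omega
  have hu₀ : u e₀ = 1 := by rwa [abs_of_nonneg (huc' e₀).1] at hu₀
  let g : E → ℤ := x + y - v
  have hg : g ∈ L := L.sub_mem (L.add_mem hx.mem hy.mem) hv
  have hg₀ : g e₀ = 1 := by simp [g, hx₀, hy₀, hv₀]
  have key : ∀ c ∈ L, c e₀ = 1 → (∀ f, 0 ≤ c f ∧ c f ≤ z f + v f) →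
      c p + c q + c s ≠ 0 ∧ c p + c q + c s ≠ 2 := fun c hc hc₀ hle => by
    have hf : ∀ f, 0 ≤ g f ∧ g f ≤ x f + y f + z f - c f := fun f => by
      have := hsum f
      have := hle f
      simp only [g, Pi.sub_apply, Pi.add_apply]
      omega
    have hgp : g p = 1 := by simp [g, hp, hvp]
    have hgq : g q = 1 := by simp only [g, Pi.sub_apply, Pi.add_apply]; omega
    have hgs : g s = 1 := by simp only [g, Pi.sub_apply, Pi.add_apply]; omega
    have hlep := hle p
    have hleq := hle q
    have hles := hle s
    refine hL.trace_ne hx hy hz hc hc₀ (fun f => ?_) ?_ ?_ ?_ hp hq hs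
      (by omega) (by omega) (by omega)
    · have := hsum f
      have := hle f
      omega
    · rintro rfl
      rcases hL.eq_or_eq_of_le_add hy hz hg hg₀ (fun f => by have := hf f; omega) with h | h
      · rw [h] at hgq
        omega
      · rw [h] at hgp
        omega
    · rintro rfl
      rcases hL.eq_or_eq_of_le_add hx hz hg hg₀ (fun f => by have := hf f; omega) with h | h
      · rw [h] at hgs
        omega
      · rw [h] at hgp
        omega
    · rintro rfl
      rcases hL.eq_or_eq_of_le_add hx hy hg hg₀ (fun f => by have := hf f; omega) with h | h
      · rw [h] at hgs
        omega
      · rw [h] at hgq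
        omega
  have h1 := key u hu hu₀ huc'
  have h2 := key (z + v - u) (L.sub_mem (L.add_mem hz.mem hv) hu) (by simp [hz₀, hv₀, hu₀])
    (fun f => by
      have := huc' f
      simp only [Pi.sub_apply, Pi.add_apply]
      omega)
  simp only [Pi.sub_apply, Pi.add_apply] at h2
  have := huc' p
  have := huc' q
  have := huc' s
  omega

end IsHeavyOff

/-- Changing the signs of coordinates other than `e₀` preserves `IsHeavyOff`. -/
lemma IsHeavyOff.comap_mulLeft {E : Type*} [Fintype E] {L : AddSubgroup (E → ℤ)} {w : E → ℕ}
    {r : ℕ} {e₀ : E} (hL : IsHeavyOff L w r e₀) {σ : E → ℤ} (hσ : ∀ f, σ f = 1 ∨ σ f = -1) :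
    IsHeavyOff (L.comap (AddMonoidHom.mulLeft σ)) w r e₀ where
  conformal y hy e he := by
    obtain ⟨u, hu, hue, huc⟩ := hL.conformal (σ * y) hy e (by
      have := hσ e
      simp only [Pi.mul_apply]
      grind)
    refine ⟨σ * u, ?_, ?_, fun f => ?_⟩
    · have : σ * (σ * u) = u := by
        ext f
        rcases hσ f with h | h <;> simp [h]
      simpa [AddSubgroup.mem_comap, this] using hu
    · rcases hσ e with h | h <;> simpa [h] using hue
    · have := huc f
      simp only [Pi.mul_apply] at this ⊢
      rcases hσ f with h | h <;> simp only [h] at this ⊢ <;> omega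
  le_norm y hy hne h₀ := by
    have h1 := hL.le_norm (σ * y) hy
      (fun h => hne (by
        ext f
        have := congrFun h f
        rcases hσ f with h' | h' <;> simpa [h'] using this))
      (by simp [h₀])
    refine h1.trans (weightedNorm.le_of_forall w fun f => ?_)
    rcases hσ f with h | h <;> simp [h]

/-- A `{0, ±1}`-valued element of `L` of weighted norm less than `r` with value `1` at `e₀`. -/
structure IsSignedLightThrough {E : Type*} [Fintype E] (L : AddSubgroup (E → ℤ)) (w : E → ℕ)
    (r : ℕ) (e₀ : E) (x : E → ℤ) : Prop where
  mem : x ∈ L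
  apply_eq : x e₀ = 1
  norm_lt : weightedNorm w x < r
  abs_le_one : ∀ f, |x f| ≤ 1

/-- Three signed light elements never meet pairwise in three elements outside the third. -/
lemma IsHeavyOff.not_signed_triangle {E : Type*} [Fintype E] {L : AddSubgroup (E → ℤ)}
    {w : E → ℕ} {r : ℕ} {e₀ : E} (hL : IsHeavyOff L w r e₀) {x y z : E → ℤ}
    (hx : IsSignedLightThrough L w r e₀ x) (hy : IsSignedLightThrough L w r e₀ y)
    (hz : IsSignedLightThrough L w r e₀ z) {p q s : E} (hp : x p ≠ 0 ∧ y p ≠ 0 ∧ z p = 0)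
    (hq : x q ≠ 0 ∧ y q = 0 ∧ z q ≠ 0) (hs : x s = 0 ∧ y s ≠ 0 ∧ z s ≠ 0) : False := by
  let σ : E → ℤ := fun f => if x f = -1 ∨ y f = -1 ∨ z f = -1 then -1 else 1
  have hσ : ∀ f, σ f = 1 ∨ σ f = -1 := fun f => by
    simp only [σ]
    split_ifs <;> simp
  have hval : ∀ f, (σ f * x f = 0 ∨ σ f * x f = 1) ∧ (σ f * y f = 0 ∨ σ f * y f = 1) ∧
      (σ f * z f = 0 ∨ σ f * z f = 1) := fun f => by
    have h1 := abs_le.1 (hx.abs_le_one f)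
    have h2 := abs_le.1 (hy.abs_le_one f)
    have h3 := abs_le.1 (hz.abs_le_one f)
    have h4 := abs_le.1 (hL.abs_sub_le_one hx.mem hy.mem hx.apply_eq hy.apply_eq hx.norm_lt
      hy.norm_lt f)
    have h5 := abs_le.1 (hL.abs_sub_le_one hx.mem hz.mem hx.apply_eq hz.apply_eq hx.norm_lt
      hz.norm_lt f)
    have h6 := abs_le.1 (hL.abs_sub_le_one hy.mem hz.mem hy.apply_eq hz.apply_eq hy.norm_lt
      hz.norm_lt f)
    simp only [σ]
    split_ifs <;> omega
  have hlight : ∀ v, IsSignedLightThrough L w r e₀ v → (∀ f, σ f * v f = 0 ∨ σ f * v f = 1) →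
      IsLightThrough (L.comap (AddMonoidHom.mulLeft σ)) w r e₀ (σ * v) := fun v hv hv1 => by
    refine ⟨?_, ?_, lt_of_le_of_lt (weightedNorm.le_of_forall w fun f => ?_) hv.norm_lt, hv1⟩
    · have : σ * (σ * v) = v := by
        ext f
        rcases hσ f with h | h <;> simp [h]
      simpa [AddSubgroup.mem_comap, this] using hv.mem
    · have := hv1 e₀
      have := hσ e₀
      simp only [Pi.mul_apply, hv.apply_eq] at *
      omega
    · rcases hσ f with h | h <;> simp [h]
  have hone : ∀ v : E → ℤ, (∀ f, σ f * v f = 0 ∨ σ f * v f = 1) → ∀ f, v f ≠ 0 →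
      (σ * v) f = 1 := fun v hv1 f hf => by
    have := hv1 f
    have := hσ f
    simp only [Pi.mul_apply]
    grind
  have hx1 := hone x fun f => (hval f).1
  have hy1 := hone y fun f => (hval f).2.1
  have hz1 := hone z fun f => (hval f).2.2
  exact (hL.comap_mulLeft hσ).not_triangle (hlight x hx fun f => (hval f).1)
    (hlight y hy fun f => (hval f).2.1) (hlight z hz fun f => (hval f).2.2)
    ⟨hx1 p hp.1, hy1 p hp.2.1, by simp [hp.2.2]⟩ ⟨hx1 q hq.1, by simp [hq.2.1], hz1 q hq.2.2⟩
    ⟨by simp [hs.1], hy1 s hs.2.1, hz1 s hs.2.2⟩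

open Matrix in
/-- The lattice of integer vectors in the kernel of a real matrix. -/
def Matrix.integerKernel {E : Type*} [Fintype E] {n : ℕ} (A : Matrix (Fin n) E ℝ) :
    AddSubgroup (E → ℤ) where
  carrier := {y | A *ᵥ (fun f => (y f : ℝ)) = 0}
  zero_mem' := by
    ext i
    simp [Matrix.mulVec, dotProduct]
  add_mem' {y z} hy hz := by
    have h : (fun f => (((y + z) f : ℤ) : ℝ)) = (fun f => (y f : ℝ)) + fun f => (z f : ℝ) := by
      ext f
      simp
    rw [Set.mem_ofPred_eq] at hy hz ⊢
    rw [h, Matrix.mulVec_add, hy, hz, add_zero]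
  neg_mem' {y} hy := by
    have h : (fun f => (((-y) f : ℤ) : ℝ)) = -fun f => (y f : ℝ) := by
      ext f
      simp
    rw [Set.mem_ofPred_eq] at hy ⊢
    rw [h, Matrix.mulVec_neg, hy, neg_zero]

lemma Matrix.IsTotallyUnimodular.isConformal_integerKernel {E : Type*} [Fintype E] {n : ℕ}
    {A : Matrix (Fin n) E ℝ} (hA : A.IsTotallyUnimodular) : A.integerKernel.IsConformal := by
  intro y hy e he
  obtain ⟨u, hu, hue, huc⟩ := hA.exists_conformal hy (e := e) (Int.cast_ne_zero.2 he)
  simp only [Int.cast_pos, Int.cast_lt_zero] at huc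
  refine ⟨u, hu, ?_, fun f => ?_⟩
  · rcases huc e with h | h | h
    · exact absurd h hue
    · simp [h.1]
    · simp [h.1]
  · have := huc f
    omega

open Matrix in
/-- The columns of `A` indexed by `S` are dependent iff some nonzero kernel vector of `A` is
supported on `S`. -/
lemma Matrix.not_linearIndependent_transpose_iff {E : Type*} [Fintype E] {n : ℕ}
    (A : Matrix (Fin n) E ℝ) (S : Set E) :
    ¬ LinearIndependent ℝ (fun e : S => A.transpose (e : E)) ↔
      ∃ k : E → ℝ, A *ᵥ k = 0 ∧ k ≠ 0 ∧ ∀ f, k f ≠ 0 → f ∈ S := by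
  have hmul : ∀ l : E →₀ ℝ, Finsupp.linearCombination ℝ A.col l = A *ᵥ l := fun l => by
    rw [Finsupp.linearCombination_apply, Finsupp.sum_fintype _ _ (by simp)]
    ext i
    simp [Matrix.mulVec, dotProduct, mul_comm]
  change ¬ LinearIndepOn ℝ A.col S ↔ _
  rw [linearIndepOn_iff]
  push Not
  constructor
  · rintro ⟨l, hlS, hl, hl0⟩
    refine ⟨l, by rw [← hmul, hl], fun h => hl0 (DFunLike.coe_injective h), fun f hf => ?_⟩
    exact (Finsupp.mem_supported ℝ l).1 hlS (by simpa using hf)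
  · rintro ⟨k, hk, hk0, hkS⟩
    refine ⟨(Finsupp.equivFunOnFinite).symm k, ?_, ?_, ?_⟩
    · rw [Finsupp.mem_supported]
      intro f hf
      exact hkS f (by simpa using hf)
    · rw [hmul]
      exact hk
    · intro h
      exact hk0 (funext fun f => DFunLike.congr_fun h f)

open Matrix in
lemma Matroid.dep_iff_exists_mulVec_eq_zero {E : Type*} [Fintype E] {M : Matroid E}
    (hE : M.E = Set.univ) {n : ℕ} {A : Matrix (Fin n) E ℝ}
    (hA : ∀ S : Set E, M.Indep S ↔ LinearIndependent ℝ (fun e : S => A.transpose (e : E)))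
    (S : Set E) : M.Dep S ↔ ∃ k : E → ℝ, A *ᵥ k = 0 ∧ k ≠ 0 ∧ ∀ f, k f ≠ 0 → f ∈ S := by
  rw [← A.not_linearIndependent_transpose_iff, ← hA, Matroid.Dep, hE]
  simp

lemma Matroid.IsCircuitSet.eq_of_dep {α : Type*} {M : Matroid α} {C D : Set α}
    (hC : M.IsCircuitSet C) (hD : M.Dep D) (h : D ⊆ C) : D = C :=
  h.eq_or_ssubset.resolve_right fun h' => hC.2 D h' hD

lemma Matroid.Dep.exists_isCircuitSet_subset {α : Type*} {M : Matroid α} [M.Finitary] {D : Set α}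
    (hD : M.Dep D) : ∃ C ⊆ D, M.IsCircuitSet C := by
  obtain ⟨C, hCD, hC⟩ := hD.exists_isCircuit_subset
  exact ⟨C, hCD, hC.dep, fun D' hD' hdep => hD'.ne ((Matroid.isCircuit_iff.1 hC).2 hdep hD'.subset)⟩

lemma weightedNorm.eq_wSet {E : Type*} [Fintype E] (w : E → ℕ) {u : E → ℤ} {C : Set E}
    (h1 : ∀ f ∈ C, |u f| = 1) (h0 : ∀ f ∉ C, u f = 0) : weightedNorm w u = wSet w C := by
  classical
  rw [wSet, finsum_mem_eq_toFinset_sum, weightedNorm]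
  push_cast
  rw [← Finset.sum_subset (Finset.subset_univ C.toFinset) fun f _ hf => by
    simp [h0 f (by simpa using hf)]]
  exact Finset.sum_congr rfl fun f hf => by rw [h1 f (by simpa using hf), mul_one]

lemma weightedNorm.wSet_le {E : Type*} [Fintype E] (w : E → ℕ) {u : E → ℤ} {C : Set E}
    (h : ∀ f ∈ C, u f ≠ 0) : (wSet w C : ℤ) ≤ weightedNorm w u := by
  classical
  rw [← weightedNorm.eq_wSet w (u := fun f => if f ∈ C then 1 else 0) (by simp +contextual)
    (by simp +contextual)]
  refine weightedNorm.le_of_forall w fun f => ?_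
  by_cases hf : f ∈ C
  · simpa [hf] using Int.one_le_abs (h f hf)
  · simp [hf]

lemma isHeavyOff_integerKernel {E : Type*} [Fintype E] {M : Matroid E} (hE : M.E = Set.univ)
    {n : ℕ} {A : Matrix (Fin n) E ℝ} (hTU : A.IsTotallyUnimodular)
    (hA : ∀ S : Set E, M.Indep S ↔ LinearIndependent ℝ (fun e : S => A.transpose (e : E)))
    {w : E → ℕ} {r : ℕ} {e₀ : E}
    (hshort : ¬ ∃ C : Set E, M.IsCircuitSet C ∧ e₀ ∉ C ∧ wSet w C < r) :
    IsHeavyOff A.integerKernel w r e₀ where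
  conformal := hTU.isConformal_integerKernel
  le_norm y hy hne h₀ := by
    have hdep : M.Dep {f | y f ≠ 0} := by
      rw [Matroid.dep_iff_exists_mulVec_eq_zero hE hA]
      refine ⟨_, hy, fun h => hne ?_, fun f hf => by simpa using hf⟩
      ext f
      simpa using congrFun h f
    obtain ⟨C, hCy, hC⟩ := hdep.exists_isCircuitSet_subset
    have hr : r ≤ wSet w C := by
      by_contra! h
      exact hshort ⟨C, hC, fun h' => hCy h' h₀, h⟩
    have := weightedNorm.wSet_le w hCy
    omega

open Matrix in
/-- Every light circuit through `e₀` is the support of a signed light vector through `e₀`. -/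
lemma Matroid.IsCircuitSet.exists_isSignedLightThrough {E : Type*} [Fintype E] {M : Matroid E}
    (hE : M.E = Set.univ) {n : ℕ} {A : Matrix (Fin n) E ℝ} (hTU : A.IsTotallyUnimodular)
    (hA : ∀ S : Set E, M.Indep S ↔ LinearIndependent ℝ (fun e : S => A.transpose (e : E)))
    {w : E → ℕ} {r : ℕ} {e₀ : E} {C : Set E} (hC : M.IsCircuitSet C) (he₀ : e₀ ∈ C)
    (hr : wSet w C < r) :
    ∃ x, IsSignedLightThrough A.integerKernel w r e₀ x ∧ ∀ f, f ∈ C ↔ x f ≠ 0 := by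
  have hdep := Matroid.dep_iff_exists_mulVec_eq_zero hE hA
  have hsupp : ∀ k : E → ℝ, A *ᵥ k = 0 → k ≠ 0 → (∀ f, k f ≠ 0 → f ∈ C) → ∀ f, f ∈ C ↔ k f ≠ 0 :=
    fun k hk hk0 hkC f => by
      have h := hC.eq_of_dep ((hdep {f | k f ≠ 0}).2 ⟨k, hk, hk0, fun _ h => h⟩) hkC
      rw [← h]
      rfl
  obtain ⟨k, hk, hk0, hkC⟩ := (hdep C).1 hC.1
  have hke : k e₀ ≠ 0 := (hsupp k hk hk0 hkC e₀).1 he₀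
  obtain ⟨u, hu, hue, huc⟩ := hTU.exists_conformal (y := k e₀ • k) (e := e₀)
    (by rw [Matrix.mulVec_smul, hk, smul_zero]) (by simpa using hke)
  have hue1 : u e₀ = 1 := by
    have hpos := mul_self_pos.2 hke
    rcases huc e₀ with h | h | h
    · exact absurd h hue
    · exact h.1
    · exact absurd h.2 (not_lt.2 hpos.le)
  have huC : ∀ f, f ∈ C ↔ u f ≠ 0 := by
    have h := hsupp (fun f => (u f : ℝ)) hu (fun h => hue (by simpa using congrFun h e₀))
      (fun f hf => hkC f fun h0 => by
        have := huc f
        simp only [Pi.smul_apply, h0, smul_zero, lt_irrefl, and_false, or_false] at this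
        simp [this] at hf)
    simpa using h
  refine ⟨u, ⟨hu, hue1, ?_, fun f => ?_⟩, huC⟩
  · rw [weightedNorm.eq_wSet w (C := C) (fun f hf => ?_) (fun f hf => ?_)]
    · exact_mod_cast hr
    · have := (huC f).1 hf
      rcases huc f with h | h | h
      · exact absurd h this
      · simp [h.1]
      · simp [h.1]
    · simpa using mt (huC f).2 hf
  · rcases huc f with h | h | h
    · simp [h]
    · simp [h.1]
    · simp [h.1]

/-- A family shatters no three-element set if no three members meet pairwise outside the third. -/
lemma Finset.vcDim_le_two {α : Type*} [DecidableEq α] {𝒜 : Finset (Finset α)}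
    (h : ∀ X ∈ 𝒜, ∀ Y ∈ 𝒜, ∀ Z ∈ 𝒜, ∀ p q s, p ∈ X → p ∈ Y → p ∉ Z → q ∈ X → q ∉ Y → q ∈ Z →
      s ∉ X → s ∈ Y → s ∈ Z → False) : 𝒜.vcDim ≤ 2 := by
  refine Finset.sup_le fun S hS => ?_
  rw [Finset.mem_shatterer] at hS
  by_contra! hcard
  obtain ⟨p, hp, q, hq, s, hs, hpq, hps, hqs⟩ := Finset.two_lt_card.1 hcard
  have htrace : ∀ a ∈ S, ∀ b ∈ S, ∃ X ∈ 𝒜, ∀ f ∈ S, f ∈ X ↔ f = a ∨ f = b := fun a ha b hb => by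
    obtain ⟨X, hX, hXT⟩ := hS (Finset.insert_subset ha (Finset.singleton_subset_iff.2 hb))
    refine ⟨X, hX, fun f hf => ?_⟩
    simpa [hf] using Finset.ext_iff.1 hXT f
  obtain ⟨X, hX, hXT⟩ := htrace p hp q hq
  obtain ⟨Y, hY, hYT⟩ := htrace p hp s hs
  obtain ⟨Z, hZ, hZT⟩ := htrace q hq s hs
  refine h X hX Y hY Z hZ p q s ?_ ?_ ?_ ?_ ?_ ?_ ?_ ?_ ?_ <;>
    simp [hXT, hYT, hZT, hp, hq, hs, hpq, hps, hqs, hpq.symm, hps.symm, hqs.symm]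

lemma Finset.card_le_of_vcDim_le_two {α : Type*} [Fintype α] [DecidableEq α]
    {𝒜 : Finset (Finset α)} (h : 𝒜.vcDim ≤ 2) :
    𝒜.card ≤ 1 + Fintype.card α + (Fintype.card α).choose 2 := by
  refine 𝒜.card_le_card_shatterer.trans (Finset.card_shatterer_le_sum_vcDim.trans ?_)
  refine (Finset.sum_le_sum_of_subset (Finset.Iic_subset_Iic.2 h)).trans_eq ?_
  simp [show Finset.Iic 2 = {0, 1, 2} from rfl, add_assoc]

/-- If a connected regular matroid `M` on a ground set of size `m ≥ 2` has no circuit of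
weight less than `r` avoiding a fixed element `ẽ`, then the number of circuits of `M`
containing `ẽ` of weight less than `r` is at most `48·(m−1)²`. -/
theorem circuits_through_element_bound {E : Type*} [Fintype E] (M : Matroid E)
    (hE : M.E = Set.univ) (hreg : M.IsRegular) (hconn : M.IsConnectedMatroid)
    (m : ℕ) (hm : Fintype.card E = m) (hm2 : 2 ≤ m) (w : E → ℕ) (r : ℕ) (hr : 0 < r)
    (etilde : E)
    (hshort : ¬ ∃ C : Set E, M.IsCircuitSet C ∧ etilde ∉ C ∧ wSet w C < r) :
    Set.ncard { C : Set E | M.IsCircuitSet C ∧ etilde ∈ C ∧ wSet w C < r }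
      ≤ 48 * (m - 1) ^ 2 := by
  classical
  obtain ⟨n, A, hTU, hA⟩ := hreg
  have hL := isHeavyOff_integerKernel hE hTU hA hshort
  let 𝒜 : Finset (Finset E) := Finset.univ.filter fun C : Finset E =>
    M.IsCircuitSet (C : Set E) ∧ etilde ∈ (C : Set E) ∧ wSet w (C : Set E) < r
  have hcard : Set.ncard { C : Set E | M.IsCircuitSet C ∧ etilde ∈ C ∧ wSet w C < r }
      ≤ 𝒜.card := by
    rw [← Set.ncard_coe_finset 𝒜]
    refine Set.ncard_le_ncard_of_injOn (fun C => C.toFinset) (fun C hC => ?_)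
      (fun C _ D _ h => Set.toFinset_inj.1 h) (Finset.finite_toSet _)
    simpa [𝒜] using hC
  have hvc : 𝒜.vcDim ≤ 2 := Finset.vcDim_le_two fun X hX Y hY Z hZ p q s
      h1 h2 h3 h4 h5 h6 h7 h8 h9 => by
    have hlift : ∀ C ∈ 𝒜, ∃ x, IsSignedLightThrough A.integerKernel w r etilde x ∧
        ∀ f, f ∈ C ↔ x f ≠ 0 := fun C hC => by
      obtain ⟨hC, he, hr⟩ := (Finset.mem_filter.1 hC).2
      exact hC.exists_isSignedLightThrough hE hTU hA he hr
    obtain ⟨x, hx, hxX⟩ := hlift X hX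
    obtain ⟨y, hy, hyY⟩ := hlift Y hY
    obtain ⟨z, hz, hzZ⟩ := hlift Z hZ
    rw [hxX] at h1 h4 h7
    rw [hyY] at h2 h5 h8
    rw [hzZ] at h3 h6 h9
    exact hL.not_signed_triangle hx hy hz ⟨h1, h2, not_not.1 h3⟩ ⟨h4, not_not.1 h5, h6⟩
      ⟨not_not.1 h7, h8, h9⟩
  have hbound := hcard.trans (Finset.card_le_of_vcDim_le_two hvc)
  rw [hm, Nat.choose_two_right] at hbound
  obtain ⟨k, rfl⟩ := Nat.exists_eq_add_of_le' hm2
  have hdiv := Nat.div_le_self ((k + 2) * (k + 2 - 1)) 2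
  simp only [show k + 2 - 1 = k + 1 by omega] at hbound hdiv ⊢
  nlinarith
end

section
/- Let E be a finite set with |E| = m, let B ⊆ 2^E be a nonempty family, let w : E → ℤ, let N be a positive integer, let w' : E → {0, 1, …, N−1}, and let c' > 0 be a real number. Let F be the face of P(B) minimizing ⟨w, x⟩ over P(B), and let F' be the face of P(B) minimizing ⟨mN·w + w', x⟩ over P(B). If ⟨w', v⟩ ≠ 0 for every nonzero v ∈ L_F with ‖v‖₁ < c', then every nonzero v ∈ L_{F'} satisfies ‖v‖₁ ≥ c'. -/
/-- The indicator vector of a finite subset `S ⊆ E`, as a point of `ℝ^E`. -/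
noncomputable def indVec {E : Type*} [DecidableEq E] (S : Finset E) : E → ℝ :=
  fun e => if e ∈ S then 1 else 0

/-- The polytope `P(B)`: the convex hull of the indicator vectors of the members of `B`. -/
noncomputable def polytopeOf {E : Type*} [Fintype E] [DecidableEq E]
    (B : Finset (Finset E)) : Set (E → ℝ) :=
  convexHull ℝ { x | ∃ S ∈ B, x = indVec S }

/-- `F` is a face of `P`: the set of minimizers over `P` of some linear functional. -/
def IsFaceOf {E : Type*} [Fintype E] (P F : Set (E → ℝ)) : Prop :=
  ∃ c : E → ℝ, F = { x ∈ P | ∀ y ∈ P, ∑ e, c e * x e ≤ ∑ e, c e * y e }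

/-- The lattice `L_F` of all integer vectors parallel to the face `F`. -/
def faceLattice {E : Type*} (F : Set (E → ℝ)) : Set (E → ℤ) :=
  { v | ∃ x₁ ∈ F, ∃ x₂ ∈ F, ∃ α : ℝ, (fun e => (v e : ℝ)) = α • (x₁ - x₂) }

/-- The `ℓ₁`-norm of an integer vector. -/
def l1norm {E : Type*} [Fintype E] (v : E → ℤ) : ℕ := ∑ e, (v e).natAbs

/-- `λ(L)`: the minimum `ℓ₁`-norm of a nonzero vector of `L` (`0` if there is none). -/
noncomputable def lambda1 {E : Type*} [Fintype E] (L : Set (E → ℤ)) : ℕ :=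
  sInf { k | ∃ v ∈ L, v ≠ 0 ∧ l1norm v = k }

/-- A weight function `w : E → ℕ` is isolating for a family `B` if there is a unique
minimum-weight member of `B`. -/
def IsIsolating {E : Type*} [DecidableEq E] (B : Finset (Finset E)) (w : E → ℕ) : Prop :=
  ∃! S, S ∈ B ∧ ∀ T ∈ B, ∑ e ∈ S, w e ≤ ∑ e ∈ T, w e

theorem indVec_mem_polytopeOf {E : Type*} [Fintype E] [DecidableEq E]
    {B : Finset (Finset E)} {S : Finset E} (hS : S ∈ B) : indVec S ∈ polytopeOf B :=
  subset_convexHull ℝ _ ⟨S, hS, rfl⟩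

theorem sum_mul_indVec {E : Type*} [Fintype E] [DecidableEq E] (c : E → ℝ) (S : Finset E) :
    ∑ e, c e * indVec S e = ∑ e ∈ S, c e := by
  simp [indVec]

/-- A linear lower bound that holds at the vertices holds on the whole polytope. -/
theorem le_sum_mul_of_mem_polytopeOf {E : Type*} [Fintype E] [DecidableEq E]
    {B : Finset (Finset E)} (c : E → ℝ) (r : ℝ) (h : ∀ S ∈ B, r ≤ ∑ e ∈ S, c e)
    {y : E → ℝ} (hy : y ∈ polytopeOf B) : r ≤ ∑ e, c e * y e := by
  have hlin : IsLinearMap ℝ (fun x : E → ℝ => ∑ e, c e * x e) :=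
    ⟨fun x z => by simp [mul_add, Finset.sum_add_distrib],
     fun a x => by simp [Finset.mul_sum, mul_left_comm]⟩
  refine convexHull_min (t := {x : E → ℝ | r ≤ ∑ e, c e * x e}) ?_
    (convex_halfSpace_ge hlin r) hy
  rintro _ ⟨S, hS, rfl⟩
  simpa only [Set.mem_ofPred_eq, sum_mul_indVec] using h S hS

theorem sum_le_card_mul_pred {E : Type*} [Fintype E] {N : ℕ}
    {w' : E → ℕ} (hw' : ∀ e, w' e < N) (S : Finset E) :
    ∑ e ∈ S, (w' e : ℤ) ≤ Fintype.card E * ((N : ℤ) - 1) := by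
  have h : ∑ e ∈ S, (w' e : ℤ) ≤ ∑ e, (w' e : ℤ) :=
    Finset.sum_le_sum_of_subset_of_nonneg (Finset.subset_univ S) fun _ _ _ => by positivity
  refine h.trans ((Finset.sum_le_card_nsmul _ _ ((N : ℤ) - 1) fun e _ => ?_).trans (by simp))
  have := hw' e
  omega

/-- If the perturbation `d` is smaller than the scale `m * N`, then the sign of the leading
term `a` is determined by that of `m * N * a + d`. -/
theorem nonneg_and_mul_le_of_scaled_nonneg {m N a d : ℤ} (hm : 0 < m) (hN : 0 < N)
    (h_lower : -(m * (N - 1)) ≤ d) (h_upper : d ≤ m * (N - 1)) (h : 0 ≤ m * N * a + d) :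
    0 ≤ a ∧ m * a ≤ m * N * a + d := by
  have hmN : 0 < m * N := mul_pos hm hN
  have hmN' : 0 ≤ m * (N - 1) := mul_nonneg hm.le (by omega)
  have ha : 0 ≤ a := by
    by_contra! hneg
    nlinarith [mul_nonneg hmN.le (show 0 ≤ -1 - a by omega)]
  refine ⟨ha, ?_⟩
  rcases ha.eq_or_lt with rfl | hpos
  · simpa using h
  · nlinarith [mul_nonneg hmN' (show 0 ≤ a - 1 by omega)]

/-- Minimizers of the combined functional `m * N * w + w'` also minimize `w`. -/
theorem sum_mul_le_of_minimizes_combined {E : Type*} [Fintype E] [DecidableEq E] [Nonempty E]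
    {B : Finset (Finset E)} (hB : B.Nonempty) (w : E → ℤ) {N : ℕ} (hN : 0 < N)
    {w' : E → ℕ} (hw' : ∀ e, w' e < N) {x : E → ℝ} (hx : x ∈ polytopeOf B)
    (hmin : ∀ y ∈ polytopeOf B,
      ∑ e, ((Fintype.card E * N * w e + w' e : ℤ) : ℝ) * x e
        ≤ ∑ e, ((Fintype.card E * N * w e + w' e : ℤ) : ℝ) * y e)
    {y : E → ℝ} (hy : y ∈ polytopeOf B) :
    ∑ e, (w e : ℝ) * x e ≤ ∑ e, (w e : ℝ) * y e := by
  have hm : 0 < Fintype.card E := Fintype.card_pos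
  set m := Fintype.card E
  let u : E → ℤ := fun e => m * N * w e + w' e
  have hu (S : Finset E) : ∑ e ∈ S, u e = m * N * ∑ e ∈ S, w e + ∑ e ∈ S, (w' e : ℤ) := by
    simp [u, Finset.sum_add_distrib, Finset.mul_sum]
  obtain ⟨T, hT, hTmin⟩ := B.exists_min_image (fun S => ∑ e ∈ S, u e) hB
  have key (S : Finset E) (hS : S ∈ B) : 0 ≤ ∑ e ∈ S, w e - ∑ e ∈ T, w e ∧
      (m : ℤ) * (∑ e ∈ S, w e - ∑ e ∈ T, w e) ≤ ∑ e ∈ S, u e - ∑ e ∈ T, u e := by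
    have h := hTmin S hS
    have hS_le := sum_le_card_mul_pred hw' S
    have hT_le := sum_le_card_mul_pred hw' T
    have hS_nonneg : 0 ≤ ∑ e ∈ S, (w' e : ℤ) := by positivity
    have hT_nonneg : 0 ≤ ∑ e ∈ T, (w' e : ℤ) := by positivity
    simp only [hu] at h ⊢
    have := nonneg_and_mul_le_of_scaled_nonneg (m := m) (N := N)
      (a := ∑ e ∈ S, w e - ∑ e ∈ T, w e)
      (d := ∑ e ∈ S, (w' e : ℤ) - ∑ e ∈ T, (w' e : ℤ))
      (by exact_mod_cast hm) (by exact_mod_cast hN) (by linarith) (by linarith) (by linarith)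
    exact ⟨this.1, by linarith [this.2]⟩
  have hwy : ((∑ e ∈ T, w e : ℤ) : ℝ) ≤ ∑ e, (w e : ℝ) * y e := by
    refine le_sum_mul_of_mem_polytopeOf _ _ (fun S hS => ?_) hy
    exact_mod_cast sub_nonneg.mp (key S hS).1
  have hux : ((∑ e ∈ T, u e - m * ∑ e ∈ T, w e : ℤ) : ℝ)
      ≤ ∑ e, ((u e : ℝ) - m * w e) * x e := by
    refine le_sum_mul_of_mem_polytopeOf _ _ (fun S hS => ?_) hx
    rw [Finset.sum_sub_distrib, ← Finset.mul_sum]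
    have := (key S hS).2
    have : ∑ e ∈ T, u e - m * ∑ e ∈ T, w e ≤ ∑ e ∈ S, u e - m * ∑ e ∈ S, w e := by linarith
    exact_mod_cast this
  have hxT : ∑ e, (u e : ℝ) * x e ≤ ((∑ e ∈ T, u e : ℤ) : ℝ) := by
    have := hmin _ (indVec_mem_polytopeOf hT)
    rw [sum_mul_indVec] at this
    exact_mod_cast this
  have hsplit : ∑ e, ((u e : ℝ) - m * w e) * x e
      = ∑ e, (u e : ℝ) * x e - m * ∑ e, (w e : ℝ) * x e := by
    simp [sub_mul, Finset.sum_sub_distrib, Finset.mul_sum, mul_assoc]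
  refine le_trans ?_ hwy
  have hm_real : (0 : ℝ) < m := by exact_mod_cast hm
  rw [hsplit, Int.cast_sub, Int.cast_mul, Int.cast_natCast] at hux
  exact le_of_mul_le_mul_left (by linarith) hm_real

/-- One round of the face-shrinking argument: if `F` is the face of `P(B)` minimizing
`⟨w, ·⟩` and `F'` is the face minimizing `⟨mN·w + w', ·⟩`, and `w'` is nonzero on every
nonzero lattice vector of `L_F` of `ℓ₁`-norm less than `c'`, then every nonzero vector
of `L_{F'}` has `ℓ₁`-norm at least `c'`. -/
theorem face_shrinking_round {E : Type*} [Fintype E] [DecidableEq E]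
    (m : ℕ) (hm : Fintype.card E = m) (B : Finset (Finset E)) (hB : B.Nonempty)
    (w : E → ℤ) (N : ℕ) (hN : 0 < N) (w' : E → ℕ) (hw' : ∀ e, w' e < N)
    (c' : ℝ) (hc' : 0 < c') (F F' : Set (E → ℝ))
    (hF : F = { x ∈ polytopeOf B | ∀ y ∈ polytopeOf B,
      ∑ e, (w e : ℝ) * x e ≤ ∑ e, (w e : ℝ) * y e })
    (hF' : F' = { x ∈ polytopeOf B | ∀ y ∈ polytopeOf B,
      ∑ e, ((m * N * w e + w' e : ℤ) : ℝ) * x e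
        ≤ ∑ e, ((m * N * w e + w' e : ℤ) : ℝ) * y e })
    (hsep : ∀ v ∈ faceLattice F, v ≠ 0 → (l1norm v : ℝ) < c' →
      ∑ e, (w' e : ℤ) * v e ≠ 0) :
    ∀ v ∈ faceLattice F', v ≠ 0 → c' ≤ (l1norm v : ℝ) := by
  subst hm
  intro v ⟨x₁, hx₁, x₂, hx₂, α, hv⟩ hv0
  have : Nonempty E := by
    by_contra hE
    rw [not_nonempty_iff] at hE
    exact hv0 (Subsingleton.elim _ _)
  have hsub : F' ⊆ F := by
    intro x hx
    rw [hF'] at hx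
    rw [hF]
    exact ⟨hx.1, fun y hy => sum_mul_le_of_minimizes_combined hB w hN hw' hx.1 hx.2 hy⟩
  by_contra! hlt
  refine hsep v ⟨x₁, hsub hx₁, x₂, hsub hx₂, α, hv⟩ hv0 hlt ?_
  have hw_eq : ∑ e, (w e : ℝ) * x₁ e = ∑ e, (w e : ℝ) * x₂ e := by
    have h₁ := hsub hx₁
    have h₂ := hsub hx₂
    rw [hF] at h₁ h₂
    exact le_antisymm (h₁.2 _ h₂.1) (h₂.2 _ h₁.1)
  have hu_eq : ∑ e, ((Fintype.card E * N * w e + w' e : ℤ) : ℝ) * x₁ e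
      = ∑ e, ((Fintype.card E * N * w e + w' e : ℤ) : ℝ) * x₂ e := by
    rw [hF'] at hx₁ hx₂
    exact le_antisymm (hx₁.2 _ hx₂.1) (hx₂.2 _ hx₁.1)
  have hsplit (x : E → ℝ) : ∑ e, ((Fintype.card E * N * w e + w' e : ℤ) : ℝ) * x e
      = Fintype.card E * N * ∑ e, (w e : ℝ) * x e + ∑ e, (w' e : ℝ) * x e := by
    rw [Finset.mul_sum, ← Finset.sum_add_distrib]
    refine Finset.sum_congr rfl fun e _ => ?_
    push_cast
    ring
  have hw'_eq : ∑ e, (w' e : ℝ) * x₁ e = ∑ e, (w' e : ℝ) * x₂ e := by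
    rw [hsplit, hsplit, hw_eq] at hu_eq
    exact add_left_cancel hu_eq
  have hzero : ∑ e, (w' e : ℝ) * (v e : ℝ) = 0 := by
    have hcoord (e : E) : (v e : ℝ) = α * (x₁ e - x₂ e) := congrFun hv e
    calc ∑ e, (w' e : ℝ) * (v e : ℝ)
        = α * (∑ e, (w' e : ℝ) * x₁ e - ∑ e, (w' e : ℝ) * x₂ e) := by
          rw [← Finset.sum_sub_distrib, Finset.mul_sum]
          refine Finset.sum_congr rfl fun e _ => ?_
          rw [hcoord]
          ring
      _ = 0 := by rw [hw'_eq, sub_self, mul_zero]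
  exact_mod_cast hzero
end
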